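/- Let χ : ℝ³ → [0,1] be a mollifier. Fix 0 < q < 1/2 and constants d, D, δ, R, R′ > 0 with 0 < δ < d²/2 and q ≤ 1/2 − δ/d². Then there exists a constant C > 0 such that for all finite Borel measures ρ, ρ′ on ℝ³ satisfying d ≤ ν(ℝ³) ≤ D and ∬_{|x−y|>R} dν(x)dν(y) ≤ δ for both ν ∈ {ρ, ρ′}, and satisfying |m_{q̃}(ρ′) − m_{q̃}(ρ)| ≤ R′ for some 0 < q̃ ≤ q, one has |m_q(χ*ρ′) − m_q(χ*ρ)| ≤ C·‖ρ′ − ρ‖_TV. -/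

import Mathlib

open MeasureTheory Measure Set Metric Filter
open scoped ENNReal NNReal RealInnerProductSpace BigOperators FourierTransform

noncomputable section

/-- Euclidean space `ℝ³`. -/
abbrev E3 := EuclideanSpace ℝ (Fin 3)

/-- A mollifier on `ℝ³`: a smooth, compactly supported, `[0,1]`-valued function with
integral one. -/
structure IsMollifier (χ : E3 → ℝ) : Prop where
  smooth : ContDiff ℝ (⊤ : ℕ∞) χ
  compactSupport : HasCompactSupport χ
  mem_Icc : ∀ y, χ y ∈ Set.Icc (0:ℝ) 1
  integral_one : (∫ y, χ y) = 1

/-- Rotation invariance of a function on `ℝ³`. -/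
def RotInv (g : E3 → ℝ) : Prop := ∀ x y : E3, ‖x‖ = ‖y‖ → g x = g y

/-- The `λ`-quantile `x^λ(ν) = sup {t : ν(-∞,t] ≤ λ·ν(ℝ)}` of a (finite Borel) measure on `ℝ`. -/
def quantile (ν : Measure ℝ) (lam : ℝ) : ℝ :=
  sSup {t : ℝ | (ν (Set.Iic t)).toReal ≤ lam * (ν Set.univ).toReal}

/-- The `j`-th marginal of a measure on `ℝ³`. -/
def marg (ρ : Measure E3) (j : Fin 3) : Measure ℝ := ρ.map (fun y => y j)

/-- The mollification `χ*ρ` of a measure `ρ` on `ℝ³`: the measure with Lebesgue density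
`x ↦ ∫ χ(x-y) dρ(y)`. -/
def mollify (χ : E3 → ℝ) (ρ : Measure E3) : Measure E3 :=
  volume.withDensity fun x => ENNReal.ofReal (∫ y, χ (x - y) ∂ρ)

/-- The `λ`-quantile `x^λ((χ*ρ)_j)` of the `j`-th marginal of the mollified measure. -/
def qtl (χ : E3 → ℝ) (ρ : Measure E3) (j : Fin 3) (lam : ℝ) : ℝ :=
  quantile (marg (mollify χ ρ) j) lam

/-- The function `f^χ_{j,t}(y) = ∫ χ(z)·1_{(-∞,t]}(y_j - z_j) dz`. -/
def fchi (χ : E3 → ℝ) (j : Fin 3) (t : ℝ) (y : E3) : ℝ :=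
  ∫ z, χ z * Set.indicator (Set.Iic t) (fun _ => (1:ℝ)) (y j - z j)

/-- The `j`-th standard basis vector of `ℝ³`. -/
def esingle (j : Fin 3) : E3 := EuclideanSpace.single j (1:ℝ)

/-- Constants `h, ℓ > 0` are adapted to `χ` if
`-∂_{y_j} f^χ_{j,t}(y) ≥ h·1_{(t-2ℓ,t+2ℓ)}(y_j)` for all `t, y, j`. -/
def Adapted (χ : E3 → ℝ) (h ℓ : ℝ) : Prop :=
  ∀ (j : Fin 3) (t : ℝ) (y : E3),
    h * Set.indicator (Set.Ioo (t - 2*ℓ) (t + 2*ℓ)) (fun _ => (1:ℝ)) (y j)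
      ≤ - fderiv ℝ (fchi χ j t) y (esingle j)

/-- Total variation distance `‖μ - ν‖_TV` of two finite measures. -/
def tv (μ ν : Measure E3) [IsFiniteMeasure μ] [IsFiniteMeasure ν] : ℝ :=
  ((μ.toSignedMeasure - ν.toSignedMeasure).totalVariation Set.univ).toReal

/-- Mollified total variation `‖g*(μ - ν)‖_TV`, i.e. the `L¹` norm of the difference of the
Lebesgue densities of `g*μ` and `g*ν`. -/
def tvMol (g : E3 → ℝ) (μ ν : Measure E3) : ℝ :=
  ∫ x, |(∫ y, g (x - y) ∂μ) - (∫ y, g (x - y) ∂ν)|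

/-- One component of the regularized median of a measure on `ℝ`:
the mean over the quantile window `[x^{1/2-q}, x^{1/2+q}]`. -/
def medComp (q : ℝ) (ν : Measure ℝ) : ℝ :=
  (∫ t in Set.Icc (quantile ν (1/2 - q)) (quantile ν (1/2 + q)), t ∂ν)
    / (ν (Set.Icc (quantile ν (1/2 - q)) (quantile ν (1/2 + q)))).toReal

/-- Assemble a vector of `ℝ³` from its coordinates. -/
def vec3 (f : Fin 3 → ℝ) : E3 := (EuclideanSpace.equiv (Fin 3) ℝ).symm f

/-- The regularized median `m_q(ρ) ∈ ℝ³` (componentwise over the marginals;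
by the junk-value conventions `m_q(0) = 0`). -/
def med (q : ℝ) (ρ : Measure E3) : E3 := vec3 fun j => medComp q (marg ρ j)

/-- The function `H^χ_{q,ρ₀} = (H₁,H₂,H₃) : ℝ³ → ℝ³` (componentwise). -/
def Hfun (χ : E3 → ℝ) (q : ℝ) (ρ₀ : Measure E3) (j : Fin 3) (y : E3) : ℝ :=
  (2 * q * (ρ₀ Set.univ).toReal)⁻¹ *
    ((∫ z, χ z *
        Set.indicator (Set.Icc (qtl χ ρ₀ j (1/2 - q)) (qtl χ ρ₀ j (1/2 + q)))
          (fun _ => (1:ℝ)) (y j - z j) *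
        (y j - z j - medComp q (marg (mollify χ ρ₀) j)))
      + (qtl χ ρ₀ j (1/2 + q) - medComp q (marg (mollify χ ρ₀) j))
          * (1/2 + q - fchi χ j (qtl χ ρ₀ j (1/2 + q)) y)
      + (medComp q (marg (mollify χ ρ₀) j) - qtl χ ρ₀ j (1/2 - q))
          * (1/2 - q - fchi χ j (qtl χ ρ₀ j (1/2 - q)) y))

/-- Mass and pair-correlation conditions `d ≤ ν(ℝ³) ≤ D`, `∬_{|x-y|>R} dν dν ≤ δ`. -/
def MassCond (d D δ R : ℝ) (ν : Measure E3) : Prop :=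
  d ≤ (ν Set.univ).toReal ∧ (ν Set.univ).toReal ≤ D ∧
    ((ν.prod ν) {p : E3 × E3 | R < dist p.1 p.2}).toReal ≤ δ

/-- Admissible triple `(ρ₀, ρ, ρ')` of measures on `ℝ³` (w.r.t. the mollifier `χ` and the
constants `q, ℓ, β, d, D, δ, R, R'`). -/
def Admissible (χ : E3 → ℝ) (q ℓ β d D δ R R' : ℝ) (ρ₀ ρ ρ' : Measure E3) : Prop :=
  (∃ qt : ℝ, 0 < qt ∧ qt ≤ q ∧
      ‖med qt ρ' - med qt ρ‖ + ‖med qt ρ - med qt ρ₀‖ ≤ R') ∧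
  MassCond d D δ R ρ₀ ∧ MassCond d D δ R ρ ∧ MassCond d D δ R ρ' ∧
  (∀ j : Fin 3,
    β ≤ (ρ₀ {y : E3 | |y j - qtl χ ρ₀ j (1/2 + q)| ≤ ℓ}).toReal ∧
    β ≤ (ρ₀ {y : E3 | |y j - qtl χ ρ₀ j (1/2 - q)| ≤ ℓ}).toReal)

/-- Convolution of two scalar functions on `ℝ³`. -/
def convFn (g₁ g₂ : E3 → ℝ) (x : E3) : ℝ := ∫ z, g₁ z * g₂ (x - z)

/-- Convolution of a scalar kernel with a vector-valued function on `ℝ³`. -/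
def convVec (k : E3 → ℝ) (F : E3 → E3) (y : E3) : E3 := ∫ z, k z • F (y - z)

/-- The boost function `𝓑(ρ) = m_q(χ*ρ) + ∫ f(y - m_q(χ*ρ)) dρ(y)`. -/
def Bfun (χ : E3 → ℝ) (q : ℝ) (f : E3 → E3) (ρ : Measure E3) : E3 :=
  med q (mollify χ ρ) + ∫ y, f (y - med q (mollify χ ρ)) ∂ρ

/-- `f ∈ C_b²(ℝ³,ℝ³)`: twice continuously differentiable with bounded derivatives
up to order two. -/
def CB2 (f : E3 → E3) : Prop :=
  ContDiff ℝ 2 f ∧ ∃ M : ℝ, ∀ y : E3,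
    ‖f y‖ ≤ M ∧ ‖fderiv ℝ f y‖ ≤ M ∧ ‖fderiv ℝ (fderiv ℝ f) y‖ ≤ M

/-- The polaron interaction `v(y) = π^{-3/2}|y|^{-2}`. -/
def vPol (y : E3) : ℝ := Real.pi ^ (-(3:ℝ)/2) * ‖y‖ ^ (-(2:ℝ))

/-- `h_ψ = |ψ|² * v`. -/
def hPek (ψ : E3 → ℂ) (x : E3) : ℝ := ∫ y, vPol (x - y) * ‖ψ y‖^2

/-- The Pekar energy
`𝓔(ψ,φ) = ‖φ‖² + ‖∇ψ‖² - 2∬ v(x-y)·Re φ(y)·|ψ(x)|² dx dy`. -/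
def PekarE (ψ φm : E3 → ℂ) : ℝ :=
  (∫ x, ‖φm x‖^2) + (∫ x, ‖fderiv ℝ ψ x‖^2)
    - 2 * ∫ pr : E3 × E3, vPol (pr.1 - pr.2) * (φm pr.2).re * ‖ψ pr.1‖^2
        ∂((volume : Measure E3).prod (volume : Measure E3))

/-- The Fourier transform of `v^Λ = χ(|∇| ≤ Λ)v`, namely
`k ↦ (2π)^{-1/2}|k|^{-1}·1_{|k| ≤ Λ}`. -/
def VLam (Λ : ℝ) (k : E3) : ℝ :=
  Set.indicator {k : E3 | ‖k‖ ≤ Λ} (fun k => (2 * Real.pi) ^ (-(1:ℝ)/2) * ‖k‖⁻¹) k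

/-- The Fourier transform of `w^Λ = (i∇/Δ)χ(|∇| > Λ)v`, namely
`k ↦ (2π)^{-1/2}|k|^{-3}·k·1_{|k| > Λ}`. -/
def WLam (Λ : ℝ) (k : E3) : E3 :=
  Set.indicator {k : E3 | Λ < ‖k‖} (fun k => ((2 * Real.pi) ^ (-(1:ℝ)/2) * (‖k‖^3)⁻¹) • k) k

/-- Pair correlation functional `∬_{|x-y| > R*} dρ(x) dρ(y)`. -/
def pairF (Rstar : ℝ) (ρ : Measure E3) : ℝ :=
  ((ρ.prod ρ) {p : E3 × E3 | Rstar < dist p.1 p.2}).toReal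

/-- The smooth cut-off functional
`F(ρ) = β₁(((ρ(ℝ³)-a)² + (∬_{|x-y|>R*}dρdρ - δ*)² - σ²)/κ²)`. -/
def Fcut (a Rstar δstar κ σ : ℝ) (β₁ : ℝ → ℝ) (ρ : Measure E3) : ℝ :=
  β₁ ((((ρ Set.univ).toReal - a)^2 + (pairF Rstar ρ - δstar)^2 - σ^2) / κ^2)


lemma quantile_mem_Icc_and_real_le (ν : Measure ℝ) [IsFiniteMeasure ν] {A B lam : ℝ}
    (h₀ : ν.real (Icc A B)ᶜ < lam * ν.real univ)
    (h₁ : ν.real (Icc A B)ᶜ < (1 - lam) * ν.real univ) :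
    quantile ν lam ∈ Icc A B ∧ ν.real (Iio (quantile ν lam)) ≤ lam * ν.real univ ∧
      lam * ν.real univ ≤ ν.real (Iic (quantile ν lam)) := by
  set S : Set ℝ := {t : ℝ | ν.real (Iic t) ≤ lam * ν.real univ} with hS
  have hq : quantile ν lam = sSup S := rfl
  have hlow : ∀ t, t < A → t ∈ S := by
    intro t ht
    have : Iic t ⊆ (Icc A B)ᶜ := fun x hx hx' => by
      have := hx'.1
      have hx : x ≤ t := hx
      linarith
    exact (measureReal_mono this).trans h₀.le
  have hup : ∀ t ∈ S, t ≤ B := by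
    intro t ht
    by_contra! hB
    have hu : ν.real univ ≤ ν.real (Iic t) + ν.real (Icc A B)ᶜ := by
      refine (measureReal_mono ?_).trans (measureReal_union_le _ _)
      intro x _
      by_cases hx : x ∈ Icc A B
      · exact Or.inl (hx.2.trans hB.le)
      · exact Or.inr hx
    have ht : ν.real (Iic t) ≤ lam * ν.real univ := ht
    linarith
  have hne : S.Nonempty := ⟨A - 1, hlow _ (by linarith)⟩
  have hbdd : BddAbove S := ⟨B, hup⟩
  have hdown : ∀ t, t < sSup S → t ∈ S := by
    intro t ht
    obtain ⟨s, hs, hts⟩ := exists_lt_of_lt_csSup hne ht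
    exact (measureReal_mono (Iic_subset_Iic.2 hts.le)).trans hs
  have hgt : ∀ t, sSup S < t → lam * ν.real univ ≤ ν.real (Iic t) := by
    intro t ht
    by_contra! h
    exact absurd (le_csSup hbdd (show t ∈ S from h.le)) (not_le.2 ht)
  rw [hq]
  refine ⟨⟨le_of_forall_lt fun t ht => ?_, csSup_le hne hup⟩, ?_, ?_⟩
  · obtain ⟨s, hts, hsA⟩ := exists_between ht
    exact hts.trans_le (le_csSup hbdd (hlow s hsA))
  · obtain ⟨u, hu, hlt, hlim⟩ := exists_seq_strictMono_tendsto (sSup S)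
    have hU : ⋃ n, Iic (u n) = Iio (sSup S) := by
      ext x
      simp only [mem_iUnion, mem_Iic, mem_Iio]
      refine ⟨fun ⟨n, hn⟩ => hn.trans_lt (hlt n), fun hx => ?_⟩
      obtain ⟨n, hn⟩ := (hlim.eventually (lt_mem_nhds hx)).exists
      exact ⟨n, hn.le⟩
    have hm : Monotone fun n => Iic (u n) := fun m n hmn => Iic_subset_Iic.2 (hu.monotone hmn)
    have := (ENNReal.tendsto_toReal (measure_ne_top ν _)).comp
      (tendsto_measure_iUnion_atTop (μ := ν) hm)
    rw [hU] at this
    exact le_of_tendsto this (Eventually.of_forall fun n => hdown _ (hlt n))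
  · obtain ⟨u, hu, hlt, hlim⟩ := exists_seq_strictAnti_tendsto (sSup S)
    have hU : ⋂ n, Iic (u n) = Iic (sSup S) := by
      ext x
      simp only [mem_iInter, mem_Iic]
      exact ⟨fun hx => ge_of_tendsto' hlim hx, fun hx n => hx.trans (hlt n).le⟩
    have hm : Antitone fun n => Iic (u n) := fun m n hmn => Iic_subset_Iic.2 (hu.antitone hmn)
    have := (ENNReal.tendsto_toReal (measure_ne_top ν _)).comp
      (tendsto_measure_iInter_atTop (μ := ν)
        (fun n => measurableSet_Iic.nullMeasurableSet) hm ⟨0, measure_ne_top ν _⟩)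
    rw [hU] at this
    exact ge_of_tendsto this (Eventually.of_forall fun n => hgt _ (hlt n))

/-- A measure that is concentrated on `[A, B]` up to mass less than `(1/2 - q) ν(ℝ)` has its
quantile window inside `[A, B]`, and the window has positive mass. -/
lemma quantile_window (ν : Measure ℝ) [IsFiniteMeasure ν] {A B q : ℝ} (hq : 0 < q)
    (h : ν.real (Icc A B)ᶜ < (1 / 2 - q) * ν.real univ) :
    A ≤ quantile ν (1 / 2 - q) ∧ quantile ν (1 / 2 + q) ≤ B ∧
      ν.real (Iio (quantile ν (1 / 2 - q))) ≤ (1 / 2 - q) * ν.real univ ∧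
      (1 / 2 - q) * ν.real univ ≤ ν.real (Iic (quantile ν (1 / 2 - q))) ∧
      ν.real (Iio (quantile ν (1 / 2 + q))) ≤ (1 / 2 + q) * ν.real univ ∧
      (1 / 2 + q) * ν.real univ ≤ ν.real (Iic (quantile ν (1 / 2 + q))) ∧
      0 < ν.real (Icc (quantile ν (1 / 2 - q)) (quantile ν (1 / 2 + q))) := by
  have hM0 : 0 ≤ ν.real univ := measureReal_nonneg
  have hM : 0 < ν.real univ := by
    refine hM0.lt_of_ne fun h0 => ?_
    rw [← h0, mul_zero] at h
    exact absurd h (not_lt.2 measureReal_nonneg)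
  have hqM : 0 < q * ν.real univ := mul_pos hq hM
  obtain ⟨ha, ha', ha''⟩ := quantile_mem_Icc_and_real_le ν (A := A) (B := B)
    (lam := 1 / 2 - q) h (by nlinarith)
  obtain ⟨hb, hb', hb''⟩ := quantile_mem_Icc_and_real_le ν (A := A) (B := B)
    (lam := 1 / 2 + q) (by nlinarith) (by nlinarith)
  refine ⟨ha.1, hb.2, ha', ha'', hb', hb'', ?_⟩
  set a := quantile ν (1 / 2 - q)
  set b := quantile ν (1 / 2 + q)
  have : ν.real (Iic b) ≤ ν.real (Iio a) + ν.real (Icc a b) := by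
    refine (measureReal_mono ?_).trans (measureReal_union_le _ _)
    intro x hx
    rcases lt_or_ge x a with h | h
    · exact Or.inl h
    · exact Or.inr ⟨h, hx⟩
  nlinarith

lemma setIntegral_id_eq_sub (ν : Measure ℝ) [IsFiniteMeasure ν] {A B a b : ℝ} (hA : A ≤ a)
    (hB : b ≤ B) :
    ∫ t in Icc a b, t ∂ν
      = B * ν.real (Icc a b) - ∫ s in Icc A B, ν.real (Icc a b ∩ Iic s) := by
  have hmeas : MeasurableSet {p : ℝ × ℝ | p.1 ≤ p.2} :=
    measurableSet_le measurable_fst measurable_snd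
  have hswap := integral_integral_swap (μ := ν.restrict (Icc a b))
    (ν := (volume : Measure ℝ).restrict (Icc A B))
    (f := fun t s => {p : ℝ × ℝ | p.1 ≤ p.2}.indicator (fun _ => (1 : ℝ)) (t, s))
    ((integrable_const (1 : ℝ)).indicator hmeas)
  have hl : ∫ t in Icc a b, (∫ s in Icc A B,
      {p : ℝ × ℝ | p.1 ≤ p.2}.indicator (fun _ => (1 : ℝ)) (t, s)) ∂ν
      = ∫ t in Icc a b, (B - t) ∂ν := by
    refine setIntegral_congr_fun measurableSet_Icc fun t ht => ?_
    have : (fun s => {p : ℝ × ℝ | p.1 ≤ p.2}.indicator (fun _ => (1 : ℝ)) (t, s))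
        = (Ici t).indicator 1 := by
      ext s; simp [indicator]
    simp only [this]
    rw [integral_indicator_one measurableSet_Ici, measureReal_restrict_apply measurableSet_Ici]
    have : Ici t ∩ Icc A B = Icc t B := by
      ext s; simp only [mem_inter_iff, mem_Ici, mem_Icc]
      exact ⟨fun h => ⟨h.1, h.2.2⟩, fun h => ⟨h.1, (hA.trans ht.1).trans h.1, h.2⟩⟩
    rw [this, Real.volume_real_Icc_of_le (ht.2.trans hB)]
  have hr : ∀ s, (∫ t in Icc a b, {p : ℝ × ℝ | p.1 ≤ p.2}.indicator (fun _ => (1 : ℝ)) (t, s) ∂ν)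
      = ν.real (Icc a b ∩ Iic s) := by
    intro s
    have : (fun t => {p : ℝ × ℝ | p.1 ≤ p.2}.indicator (fun _ => (1 : ℝ)) (t, s))
        = (Iic s).indicator 1 := by
      ext t; simp [indicator]
    rw [this, integral_indicator_one measurableSet_Iic,
      measureReal_restrict_apply measurableSet_Iic, inter_comm]
  rw [hl] at hswap
  simp only [hr] at hswap
  rw [← hswap, integral_sub (integrable_const _)]
  · simp [mul_comm]
  · exact (continuous_id.continuousOn).integrableOn_compact isCompact_Icc

lemma medComp_mem_Icc (ν : Measure ℝ) [IsFiniteMeasure ν] {A B q : ℝ} (hq : 0 < q)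
    (h : ν.real (Icc A B)ᶜ < (1 / 2 - q) * ν.real univ) : medComp q ν ∈ Icc A B := by
  obtain ⟨ha, hb, -, -, -, -, hpos⟩ := quantile_window ν hq h
  have hint : IntegrableOn (fun t : ℝ => t)
      (Icc (quantile ν (1 / 2 - q)) (quantile ν (1 / 2 + q))) ν :=
    (continuous_id.continuousOn).integrableOn_compact isCompact_Icc
  have hdef : medComp q ν
    = (∫ t in Icc (quantile ν (1 / 2 - q)) (quantile ν (1 / 2 + q)), t ∂ν)
      / ν.real (Icc (quantile ν (1 / 2 - q)) (quantile ν (1 / 2 + q))) := rfl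
  rw [hdef]
  constructor
  · rw [le_div_iff₀ hpos]
    have := setIntegral_mono_on (μ := ν) (integrable_const A).integrableOn hint measurableSet_Icc
      (fun t ht => ha.trans ht.1)
    simpa [mul_comm] using this
  · rw [div_le_iff₀ hpos]
    have := setIntegral_mono_on (μ := ν) hint (integrable_const B).integrableOn measurableSet_Icc
      (fun t ht => ht.2.trans hb)
    simpa [mul_comm] using this

/-- For an atomless measure the truncated distribution function on the quantile window is
a clamp of the normalized distribution function. -/
lemma real_window_inter_Iic (ν : Measure ℝ) [IsFiniteMeasure ν] [NullSingletonClass ν] {A B q : ℝ}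
    (hq : 0 < q) (h : ν.real (Icc A B)ᶜ < (1 / 2 - q) * ν.real univ) (hM : 0 < ν.real univ)
    (s : ℝ) :
    ν.real (Icc (quantile ν (1 / 2 - q)) (quantile ν (1 / 2 + q)) ∩ Iic s)
      = ν.real univ * (max (1 / 2 - q) (min (1 / 2 + q) (ν.real (Iic s) / ν.real univ))
          - (1 / 2 - q)) := by
  obtain ⟨-, -, h1, h2, h3, h4, -⟩ := quantile_window ν hq h
  set a := quantile ν (1 / 2 - q)
  set b := quantile ν (1 / 2 + q)
  have hatom : ∀ x, ν.real (Iio x) = ν.real (Iic x) := fun x =>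
    measureReal_congr Iio_ae_eq_Iic
  rw [hatom] at h1 h3
  have hFa := le_antisymm h1 h2
  have hFb := le_antisymm h3 h4
  have hqM : 0 < q * ν.real univ := mul_pos hq hM
  have hab : a ≤ b := by
    by_contra! hlt
    have := measureReal_mono (μ := ν) (Iic_subset_Iic.2 hlt.le)
    nlinarith
  have hIcc : ∀ x, a ≤ x → ν.real (Icc a x) = ν.real (Iic x) - ν.real (Iic a) := by
    intro x hx
    rw [← hatom a, eq_sub_iff_add_eq, add_comm, ← measureReal_union _ measurableSet_Icc,
      Iio_union_Icc_eq_Iic hx]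
    rw [disjoint_left]
    exact fun y hy hy' => absurd hy'.1 (not_le.2 hy)
  rcases lt_or_ge s a with hs | hs
  · have h0 : Icc a b ∩ Iic s = ∅ := by
      ext x; simp only [mem_inter_iff, mem_Icc, mem_Iic, mem_empty_iff_false, iff_false]
      rintro ⟨⟨h, -⟩, h'⟩; linarith
    have : ν.real (Iic s) / ν.real univ ≤ 1 / 2 - q := by
      rw [div_le_iff₀ hM, ← hFa]
      exact measureReal_mono (Iic_subset_Iic.2 hs.le)
    rw [h0, max_eq_left ((min_le_right _ _).trans this)]
    simp
  · rcases le_total s b with hsb | hsb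
    · have h0 : Icc a b ∩ Iic s = Icc a s := by
        ext x; simp only [mem_inter_iff, mem_Icc, mem_Iic]
        exact ⟨fun h => ⟨h.1.1, h.2⟩, fun h => ⟨⟨h.1, h.2.trans hsb⟩, h.2⟩⟩
      have hl : 1 / 2 - q ≤ ν.real (Iic s) / ν.real univ := by
        rw [le_div_iff₀ hM, ← hFa]
        exact measureReal_mono (Iic_subset_Iic.2 hs)
      have hr : ν.real (Iic s) / ν.real univ ≤ 1 / 2 + q := by
        rw [div_le_iff₀ hM, ← hFb]
        exact measureReal_mono (Iic_subset_Iic.2 hsb)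
      rw [h0, hIcc s hs, min_eq_right hr, max_eq_right hl, hFa]
      field_simp
    · have h0 : Icc a b ∩ Iic s = Icc a b := inter_eq_left.2 fun x hx => hx.2.trans hsb
      have hr : 1 / 2 + q ≤ ν.real (Iic s) / ν.real univ := by
        rw [le_div_iff₀ hM, ← hFb]
        exact measureReal_mono (Iic_subset_Iic.2 hsb)
      rw [h0, hIcc b hab, min_eq_left hr, max_eq_right (by linarith), hFa, hFb]
      ring

lemma medComp_eq_sub_integral (ν : Measure ℝ) [IsFiniteMeasure ν] [NullSingletonClass ν] {A B q : ℝ}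
    (hq : 0 < q) (h : ν.real (Icc A B)ᶜ < (1 / 2 - q) * ν.real univ) (hM : 0 < ν.real univ) :
    medComp q ν = B - (2 * q)⁻¹ * ∫ s in Icc A B,
      (max (1 / 2 - q) (min (1 / 2 + q) (ν.real (Iic s) / ν.real univ)) - (1 / 2 - q)) := by
  obtain ⟨ha, hb, -, -, h3, h4, -⟩ := quantile_window ν hq h
  have hclamp := real_window_inter_Iic ν hq h hM
  have hK : ν.real (Icc (quantile ν (1 / 2 - q)) (quantile ν (1 / 2 + q)))
      = 2 * q * ν.real univ := by
    have := hclamp (quantile ν (1 / 2 + q))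
    rw [inter_eq_left.2 fun x hx => hx.2, min_eq_left, max_eq_right (by linarith)] at this
    · rw [this]; ring
    · rwa [le_div_iff₀ hM]
  have hdef : medComp q ν
    = (∫ t in Icc (quantile ν (1 / 2 - q)) (quantile ν (1 / 2 + q)), t ∂ν)
      / ν.real (Icc (quantile ν (1 / 2 - q)) (quantile ν (1 / 2 + q))) := rfl
  rw [hdef, setIntegral_id_eq_sub ν ha hb, hK]
  simp only [hclamp]
  rw [integral_const_mul]
  field_simp

/-- The regularized median is Lipschitz for atomless measures concentrated on a common
interval, with respect to the uniform distance of distribution functions. -/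
lemma abs_medComp_sub_le (ν ν' : Measure ℝ) [IsFiniteMeasure ν] [NullSingletonClass ν]
    [IsFiniteMeasure ν'] [NullSingletonClass ν'] {A B q d T : ℝ} (hq : 0 < q) (hd : 0 < d)
    (hAB : A ≤ B)
    (h : ν.real (Icc A B)ᶜ < (1 / 2 - q) * ν.real univ)
    (h' : ν'.real (Icc A B)ᶜ < (1 / 2 - q) * ν'.real univ)
    (hM : d ≤ ν.real univ) (hM' : d ≤ ν'.real univ)
    (hT : ∀ s, MeasurableSet s → |ν'.real s - ν.real s| ≤ T) :
    |medComp q ν' - medComp q ν| ≤ (B - A) / (q * d) * T := by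
  have hMp := hd.trans_le hM
  have hMp' := hd.trans_le hM'
  rw [medComp_eq_sub_integral ν hq h hMp, medComp_eq_sub_integral ν' hq h' hMp']
  have hint : ∀ μ : Measure ℝ, IsFiniteMeasure μ → IntegrableOn (fun s =>
      max (1 / 2 - q) (min (1 / 2 + q) (μ.real (Iic s) / μ.real univ)) - (1 / 2 - q))
      (Icc A B) := by
    intro μ _
    refine MonotoneOn.integrableOn_isCompact isCompact_Icc fun s _ t _ hst => ?_
    have := measureReal_mono (μ := μ) (Iic_subset_Iic.2 hst)
    gcongr
  have key : ∀ s ∈ Icc A B,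
      ‖(max (1 / 2 - q) (min (1 / 2 + q) (ν.real (Iic s) / ν.real univ)) - (1 / 2 - q))
        - (max (1 / 2 - q) (min (1 / 2 + q) (ν'.real (Iic s) / ν'.real univ)) - (1 / 2 - q))‖
      ≤ 2 * T / d := by
    intro s _
    rw [sub_sub_sub_cancel_right, Real.norm_eq_abs]
    refine (abs_max_sub_max_le_max _ _ _ _).trans ?_
    rw [sub_self, abs_zero, max_eq_right (abs_nonneg _)]
    refine (abs_min_sub_min_le_max _ _ _ _).trans ?_
    rw [sub_self, abs_zero, max_eq_right (abs_nonneg _)]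
    have e : ν.real (Iic s) / ν.real univ - ν'.real (Iic s) / ν'.real univ
        = (ν'.real (Iic s) / ν'.real univ * (ν'.real univ - ν.real univ)
          - (ν'.real (Iic s) - ν.real (Iic s))) / ν.real univ := by
      field_simp
      ring
    have hle1 : |ν'.real (Iic s) / ν'.real univ| ≤ 1 := by
      rw [abs_of_nonneg (by positivity), div_le_one hMp']
      exact measureReal_mono (subset_univ _)
    have hT0 : 0 ≤ T := (abs_nonneg _).trans (hT univ MeasurableSet.univ)
    rw [e, abs_div, abs_of_pos hMp]
    refine div_le_div₀ (by positivity) ?_ hd hM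
    refine (abs_sub _ _).trans ?_
    rw [abs_mul]
    have h1 := hT (Iic s) measurableSet_Iic
    have h2 := mul_le_mul hle1 (hT univ MeasurableSet.univ) (abs_nonneg _) zero_le_one
    linarith
  have hI := norm_setIntegral_le_of_norm_le_const (μ := volume) (s := Icc A B)
    (by simp) key
  rw [integral_sub (hint ν ‹_›) (hint ν' ‹_›), Real.volume_real_Icc_of_le hAB,
    Real.norm_eq_abs] at hI
  rw [sub_sub_sub_cancel_left, ← mul_sub, abs_mul, abs_of_pos (by positivity)]
  calc _ ≤ (2 * q)⁻¹ * (2 * T / d * (B - A)) := by gcongr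
    _ = _ := by field_simp

lemma le_add_totalVariation {α : Type*} [MeasurableSpace α] (μ ν : Measure α) [IsFiniteMeasure μ]
    [IsFiniteMeasure ν] :
    μ ≤ ν + (μ.toSignedMeasure - ν.toSignedMeasure).totalVariation := by
  set s := μ.toSignedMeasure - ν.toSignedMeasure with hs
  refine Measure.le_iff.2 fun i hi => ?_
  have h := s.apply_eq_posPart_real_sub_negPart_real hi
  rw [hs, Measure.toSignedMeasure_sub_apply hi, ← hs] at h
  have hn : 0 ≤ s.toJordanDecomposition.negPart.real i := measureReal_nonneg
  have : μ.real i ≤ (ν + s.totalVariation).real i := by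
    rw [measureReal_add_apply, SignedMeasure.totalVariation, measureReal_add_apply]
    linarith
  exact (ENNReal.toReal_le_toReal (measure_ne_top _ _) (measure_ne_top _ _)).1 this

namespace IsMollifier

variable {χ : E3 → ℝ}

lemma continuous (hχ : IsMollifier χ) : Continuous χ := hχ.smooth.continuous

lemma lintegral_eq_one (hχ : IsMollifier χ) (y : E3) :
    ∫⁻ x, ENNReal.ofReal (χ (x - y)) = 1 := by
  rw [lintegral_sub_right_eq_self (μ := (volume : Measure E3)) (fun x => ENNReal.ofReal (χ x)) y,
    ← ofReal_integral_eq_lintegral_ofReal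
      (hχ.continuous.integrable_of_hasCompactSupport hχ.compactSupport)
      (Eventually.of_forall fun x => (hχ.mem_Icc x).1), hχ.integral_one, ENNReal.ofReal_one]

lemma mollify_apply (hχ : IsMollifier χ) (ρ : Measure E3) [IsFiniteMeasure ρ] {s : Set E3}
    (hs : MeasurableSet s) :
    mollify χ ρ s = ∫⁻ y, (∫⁻ x in s, ENNReal.ofReal (χ (x - y))) ∂ρ := by
  have hden : ∀ x, ENNReal.ofReal (∫ y, χ (x - y) ∂ρ)
      = ∫⁻ y, ENNReal.ofReal (χ (x - y)) ∂ρ := by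
    intro x
    refine ofReal_integral_eq_lintegral_ofReal ?_
      (Eventually.of_forall fun y => (hχ.mem_Icc _).1)
    refine Integrable.of_bound (C := 1)
      (hχ.continuous.comp (continuous_const.sub continuous_id)).aestronglyMeasurable
      (Eventually.of_forall fun y => ?_)
    rw [Real.norm_eq_abs, abs_of_nonneg (hχ.mem_Icc _).1]
    exact (hχ.mem_Icc _).2
  rw [mollify, withDensity_apply _ hs]
  simp only [hden]
  refine lintegral_lintegral_swap ?_
  exact (ENNReal.measurable_ofReal.comp (hχ.continuous.comp
    (continuous_fst.sub continuous_snd)).measurable).aemeasurable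

lemma mollify_univ (hχ : IsMollifier χ) (ρ : Measure E3) [IsFiniteMeasure ρ] :
    mollify χ ρ univ = ρ univ := by
  rw [hχ.mollify_apply ρ MeasurableSet.univ]
  simp [hχ.lintegral_eq_one]

lemma isFiniteMeasure_mollify (hχ : IsMollifier χ) (ρ : Measure E3) [IsFiniteMeasure ρ] :
    IsFiniteMeasure (mollify χ ρ) :=
  ⟨by rw [hχ.mollify_univ ρ]; exact measure_lt_top _ _⟩

lemma mollify_real_le (hχ : IsMollifier χ) {ρ ρ' τ : Measure E3} [IsFiniteMeasure ρ]
    [IsFiniteMeasure ρ'] [IsFiniteMeasure τ] (h : ρ' ≤ ρ + τ) {s : Set E3}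
    (hs : MeasurableSet s) :
    (mollify χ ρ').real s ≤ (mollify χ ρ).real s + τ.real univ := by
  have := hχ.isFiniteMeasure_mollify ρ
  have hle : mollify χ ρ' s ≤ mollify χ ρ s + τ univ := by
    rw [hχ.mollify_apply ρ hs, hχ.mollify_apply ρ' hs]
    refine (lintegral_mono' h le_rfl).trans ?_
    rw [lintegral_add_measure]
    gcongr
    refine (lintegral_mono (g := fun _ => 1) fun y => ?_).trans (by simp)
    exact (setLIntegral_le_lintegral _ _).trans (hχ.lintegral_eq_one y).le
  have := ENNReal.toReal_mono
    (ENNReal.add_ne_top.2 ⟨measure_ne_top _ _, measure_ne_top _ _⟩) hle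
  rwa [ENNReal.toReal_add (measure_ne_top _ _) (measure_ne_top _ _)] at this

lemma abs_mollify_real_sub_le (hχ : IsMollifier χ) (ρ ρ' : Measure E3) [IsFiniteMeasure ρ]
    [IsFiniteMeasure ρ'] {s : Set E3} (hs : MeasurableSet s) :
    |(mollify χ ρ').real s - (mollify χ ρ).real s| ≤ tv ρ' ρ := by
  have h1 := hχ.mollify_real_le (le_add_totalVariation ρ' ρ) hs
  have h2 := le_add_totalVariation ρ ρ'
  rw [← neg_sub, SignedMeasure.totalVariation_neg] at h2
  have h2 := hχ.mollify_real_le h2 hs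
  have e : tv ρ' ρ
    = (ρ'.toSignedMeasure - ρ.toSignedMeasure).totalVariation.real univ := rfl
  rw [e, abs_sub_le_iff]
  constructor <;> linarith

lemma mollify_real_le_of_thickening (hχ : IsMollifier χ) (ρ : Measure E3) [IsFiniteMeasure ρ]
    {r : ℝ} (hr : Function.support χ ⊆ closedBall 0 r) {s t : Set E3} (hs : MeasurableSet s)
    (ht : MeasurableSet t) (hst : ∀ x ∈ s, ∀ y, dist x y ≤ r → y ∈ t) :
    (mollify χ ρ).real s ≤ ρ.real t := by
  have hle : mollify χ ρ s ≤ ρ t := by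
    rw [hχ.mollify_apply ρ hs, ← lintegral_indicator_one ht]
    refine lintegral_mono fun y => ?_
    by_cases hy : y ∈ t
    · simp only [indicator_of_mem hy, Pi.one_apply]
      exact (setLIntegral_le_lintegral _ _).trans (hχ.lintegral_eq_one y).le
    · rw [indicator_of_notMem hy, nonpos_iff_eq_zero]
      refine setLIntegral_eq_zero hs fun x hx => ?_
      have : χ (x - y) = 0 := by
        by_contra h
        have := hr (Function.mem_support.2 h)
        rw [mem_closedBall_zero_iff, ← dist_eq_norm] at this
        exact hy (hst x hx y this)
      simp [this]
  exact ENNReal.toReal_mono (measure_ne_top _ _) hle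

end IsMollifier

lemma measurable_coord (j : Fin 3) : Measurable fun y : E3 => y j :=
  (EuclideanSpace.proj (𝕜 := ℝ) j).continuous.measurable

lemma abs_coord_sub_le_dist (x y : E3) (j : Fin 3) : |x j - y j| ≤ dist x y := by
  rw [dist_eq_norm]
  exact PiLp.norm_apply_le (x - y) j

instance isFiniteMeasure_marg (ρ : Measure E3) [IsFiniteMeasure ρ] (j : Fin 3) :
    IsFiniteMeasure (marg ρ j) := by
  unfold marg; infer_instance

lemma marg_real_apply (ρ : Measure E3) (j : Fin 3) {s : Set ℝ} (hs : MeasurableSet s) :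
    (marg ρ j).real s = ρ.real ((fun y : E3 => y j) ⁻¹' s) :=
  map_measureReal_apply (measurable_coord j) hs

lemma marg_real_univ (ρ : Measure E3) (j : Fin 3) : (marg ρ j).real univ = ρ.real univ :=
  marg_real_apply ρ j MeasurableSet.univ

lemma volume_coord_hyperplane (j : Fin 3) (t : ℝ) : volume {y : E3 | y j = t} = 0 := by
  have h := (EuclideanSpace.volume_preserving_symm_measurableEquiv_toLp (Fin 3)).measure_preimage
    (s := {f : Fin 3 → ℝ | f j = t})
    (measurableSet_eq_fun (measurable_pi_apply j) measurable_const).nullMeasurableSet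
  exact h.trans (Measure.pi_hyperplane (fun _ => (volume : Measure ℝ)) j t)

instance nullSingletonClass_marg_mollify (χ : E3 → ℝ) (ρ : Measure E3) (j : Fin 3) :
    NullSingletonClass (marg (mollify χ ρ) j) where
  measure_singleton t := by
    rw [marg, Measure.map_apply (measurable_coord j) (measurableSet_singleton t)]
    exact withDensity_absolutelyContinuous _ _ (volume_coord_hyperplane j t)

/-- If the pairs at distance more than `R` carry little mass, then most of the mass lies in a
single ball of radius `2R`. -/
lemma exists_real_compl_closedBall_lt {ρ : Measure E3} [IsFiniteMeasure ρ] {R c δ : ℝ}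
    (hR : 0 < R) (hc : 0 < c) (hcM : c < ρ.real univ / 2)
    (hδ : (ρ.prod ρ).real {p : E3 × E3 | R < dist p.1 p.2} ≤ δ) (hδc : δ ≤ c * ρ.real univ) :
    ∃ x, ρ.real (closedBall x (2 * R))ᶜ < c := by
  by_contra! hcon
  have hS : MeasurableSet {p : E3 × E3 | R < dist p.1 p.2} :=
    measurableSet_lt measurable_const (measurable_fst.dist measurable_snd)
  have hsec : ∀ x, Prod.mk x ⁻¹' {p : E3 × E3 | R < dist p.1 p.2} = (closedBall x R)ᶜ := by
    intro x; ext y; simp [dist_comm]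
  have hint : ∫ x, ρ.real (closedBall x R)ᶜ ∂ρ
      = (ρ.prod ρ).real {p : E3 × E3 | R < dist p.1 p.2} := by
    rw [measureReal_def, Measure.prod_apply hS]
    simp only [hsec, measureReal_def]
    refine integral_toReal ?_ (Eventually.of_forall fun x => measure_lt_top _ _)
    have := measurable_measure_prodMk_left (ν := ρ) hS
    simp only [hsec] at this
    exact this.aemeasurable
  have hmeas : Measurable fun x => ρ.real (closedBall x R)ᶜ := by
    have := (measurable_measure_prodMk_left (ν := ρ) hS).ennreal_toReal
    simp only [hsec] at this
    exact this
  have hintg : Integrable (fun x => ρ.real (closedBall x R)ᶜ) ρ :=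
    Integrable.of_bound (C := ρ.real univ) hmeas.aestronglyMeasurable
      (Eventually.of_forall fun x => by
        rw [Real.norm_eq_abs, abs_of_nonneg measureReal_nonneg]
        exact measureReal_mono (subset_univ _))
  have hge : ∀ x, c ≤ ρ.real (closedBall x R)ᶜ := fun x =>
    (hcon x).trans (measureReal_mono
      (compl_subset_compl.2 (closedBall_subset_closedBall (by linarith))))
  have hae : (fun x => ρ.real (closedBall x R)ᶜ - c) =ᵐ[ρ] 0 := by
    refine (integral_eq_zero_iff_of_nonneg (fun x => sub_nonneg.2 (hge x))
      (hintg.sub (integrable_const c))).1 (le_antisymm ?_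
        (integral_nonneg fun x => sub_nonneg.2 (hge x)))
    rw [integral_sub hintg (integrable_const c), hint, integral_const, smul_eq_mul]
    linarith
  have hne : NeZero ρ := ⟨fun h => by simp [h] at hcM; linarith⟩
  obtain ⟨x, hx⟩ := hae.exists
  have hx : ρ.real (closedBall x R)ᶜ = c := sub_eq_zero.1 hx
  have hmass : ∀ z, ρ.real (closedBall z R)ᶜ = c → ρ.real (closedBall z R) = ρ.real univ - c := by
    intro z hz
    rw [measureReal_compl measurableSet_closedBall] at hz
    linarith
  have hnull : ρ (closedBall x (2 * R))ᶜ = 0 := by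
    refine measure_mono_null (fun y hy => ?_) (ae_iff.1 hae)
    intro hyc
    have hyc : ρ.real (closedBall y R)ᶜ = c := sub_eq_zero.1 hyc
    have hdist : 2 * R < dist y x := by simpa using hy
    have hdisj : Disjoint (closedBall x R) (closedBall y R) :=
      closedBall_disjoint_closedBall (by rw [dist_comm]; linarith)
    have hu := measureReal_union (μ := ρ) hdisj measurableSet_closedBall
    have := measureReal_mono (μ := ρ) (subset_univ (closedBall x R ∪ closedBall y R))
    rw [hu, hmass x hx, hmass y hyc] at this
    linarith
  have := hcon x
  rw [measureReal_def, hnull, ENNReal.toReal_zero] at this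
  linarith

lemma marg_real_compl_Icc_le (ρ : Measure E3) [IsFiniteMeasure ρ] (x : E3) (j : Fin 3) (L : ℝ) :
    (marg ρ j).real (Icc (x j - L) (x j + L))ᶜ ≤ ρ.real (closedBall x L)ᶜ := by
  rw [marg_real_apply _ _ measurableSet_Icc.compl]
  refine measureReal_mono fun y hy hy' => hy ?_
  have := abs_le.1 ((abs_coord_sub_le_dist y x j).trans hy')
  constructor <;> linarith

lemma IsMollifier.marg_mollify_real_compl_Icc_le {χ : E3 → ℝ} (hχ : IsMollifier χ)
    (ρ : Measure E3) [IsFiniteMeasure ρ] {r : ℝ} (hr : Function.support χ ⊆ closedBall 0 r)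
    (x : E3) (j : Fin 3) {L A B : ℝ} (hA : A ≤ x j - (L + r)) (hB : x j + (L + r) ≤ B) :
    (marg (mollify χ ρ) j).real (Icc A B)ᶜ ≤ ρ.real (closedBall x L)ᶜ := by
  rw [marg_real_apply _ _ measurableSet_Icc.compl]
  refine hχ.mollify_real_le_of_thickening ρ hr (measurable_coord j measurableSet_Icc.compl)
    measurableSet_closedBall.compl fun z hz y hzy hy => hz ?_
  have h : dist z x ≤ L + r := by
    have := dist_triangle z y x
    have hy : dist y x ≤ L := hy
    linarith
  have := abs_le.1 ((abs_coord_sub_le_dist z x j).trans h)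
  constructor <;> linarith

lemma med_apply (q : ℝ) (ρ : Measure E3) (j : Fin 3) : med q ρ j = medComp q (marg ρ j) := rfl

lemma norm_le_three_mul {v : E3} {K : ℝ} (h : ∀ j, |v j| ≤ K) : ‖v‖ ≤ 3 * K := by
  have hK : 0 ≤ K := (abs_nonneg _).trans (h 0)
  rw [EuclideanSpace.norm_eq]
  refine Real.sqrt_le_iff.2 ⟨by positivity, ?_⟩
  calc ∑ i, ‖v i‖ ^ 2 ≤ ∑ _i : Fin 3, K ^ 2 :=
        Finset.sum_le_sum fun i _ => pow_le_pow_left₀ (norm_nonneg _) (h i) 2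
    _ = 3 * K ^ 2 := by simp
    _ ≤ (3 * K) ^ 2 := by nlinarith [sq_nonneg K]

lemma MassCond.exists_real_compl_closedBall_lt {ρ : Measure E3} [IsFiniteMeasure ρ]
    {q d D δ R : ℝ} (h : MassCond d D δ R ρ) (hq0 : 0 < q) (hq : q < 1 / 2) (hd : 0 < d)
    (hR : 0 < R) (hqδ : q ≤ 1 / 2 - δ / d ^ 2) :
    ∃ x, ρ.real (closedBall x (2 * R))ᶜ < (1 / 2 - q) * ρ.real univ := by
  have hM : d ≤ ρ.real univ := h.1
  have hMp := hd.trans_le hM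
  refine _root_.exists_real_compl_closedBall_lt hR (mul_pos (by linarith) hMp) (by nlinarith)
    h.2.2 ?_
  have h1 : δ ≤ (1 / 2 - q) * d ^ 2 := by
    rw [← div_le_iff₀ (by positivity)]
    linarith
  have h2 : d ^ 2 ≤ ρ.real univ * ρ.real univ := by nlinarith
  have h3 : (1 / 2 - q) * d ^ 2 ≤ (1 / 2 - q) * (ρ.real univ * ρ.real univ) :=
    mul_le_mul_of_nonneg_left h2 (by linarith)
  linarith

/-- Lipschitz continuity of the regularized median of the mollified measure. -/
theorem stmt5 (χ : E3 → ℝ) (hχ : IsMollifier χ) (q d D δ R R' : ℝ)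
    (hq0 : 0 < q) (hq : q < 1/2) (hd : 0 < d) (hD : 0 < D) (hδ0 : 0 < δ)
    (hR : 0 < R) (hR' : 0 < R') (hδ : δ < d^2/2) (hqδ : q ≤ 1/2 - δ/d^2) :
    ∃ C > (0:ℝ),
      ∀ (ρ ρ' : Measure E3) [IsFiniteMeasure ρ] [IsFiniteMeasure ρ'],
        MassCond d D δ R ρ → MassCond d D δ R ρ' →
        (∃ qt : ℝ, 0 < qt ∧ qt ≤ q ∧ ‖med qt ρ' - med qt ρ‖ ≤ R') →
        ‖med q (mollify χ ρ') - med q (mollify χ ρ)‖ ≤ C * tv ρ' ρ := by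
  obtain ⟨r, hr⟩ := hχ.compactSupport.isCompact.isBounded.subset_closedBall 0
  have hr : Function.support χ ⊆ closedBall 0 (max r 0) :=
    (subset_tsupport χ).trans (hr.trans (closedBall_subset_closedBall (le_max_left _ _)))
  have hr0 : 0 ≤ max r 0 := le_max_right _ _
  set r₀ := max r 0
  set L := 2 * R + r₀ + (R' + 4 * R) with hL
  have hLp : 0 < L := by positivity
  refine ⟨3 * (2 * L / (q * d)), by positivity, ?_⟩
  rintro ρ ρ' _ _ hρ hρ' ⟨qt, hqt0, hqt, hmed⟩
  have := hχ.isFiniteMeasure_mollify ρ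
  have := hχ.isFiniteMeasure_mollify ρ'
  obtain ⟨x, hx⟩ := hρ.exists_real_compl_closedBall_lt hq0 hq hd hR hqδ
  obtain ⟨x', hx'⟩ := hρ'.exists_real_compl_closedBall_lt hq0 hq hd hR hqδ
  rw [mul_assoc]
  refine norm_le_three_mul fun j => ?_
  have hcenter : |x' j - x j| ≤ R' + 4 * R := by
    have hloc : ∀ (μ : Measure E3) [IsFiniteMeasure μ] (z : E3),
        μ.real (closedBall z (2 * R))ᶜ < (1 / 2 - q) * μ.real univ →
        medComp qt (marg μ j) ∈ Icc (z j - 2 * R) (z j + 2 * R) := by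
      intro μ _ z hz
      refine medComp_mem_Icc _ hqt0 ((marg_real_compl_Icc_le μ z j _).trans_lt (hz.trans_le ?_))
      rw [marg_real_univ]
      gcongr
    obtain ⟨h1, h2⟩ := hloc ρ x hx
    obtain ⟨h3, h4⟩ := hloc ρ' x' hx'
    obtain ⟨h5, h6⟩ := abs_le.1 ((PiLp.norm_apply_le (med qt ρ' - med qt ρ) j).trans hmed)
    rw [PiLp.sub_apply, med_apply, med_apply] at h5 h6
    rw [abs_le]
    constructor <;> linarith
  obtain ⟨hc1, hc2⟩ := abs_le.1 hcenter
  have hmass : ∀ (μ : Measure E3) [IsFiniteMeasure μ],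
      (marg (mollify χ μ) j).real univ = μ.real univ := fun μ _ => by
    rw [marg_real_univ, measureReal_def, hχ.mollify_univ, measureReal_def]
  have hmain := abs_medComp_sub_le (marg (mollify χ ρ) j) (marg (mollify χ ρ') j)
    (A := x j - L) (B := x j + L) (T := tv ρ' ρ) hq0 hd (by linarith)
    (by
      rw [hmass]
      exact (hχ.marg_mollify_real_compl_Icc_le ρ hr x j (by linarith) (by linarith)).trans_lt hx)
    (by
      rw [hmass]
      exact (hχ.marg_mollify_real_compl_Icc_le ρ' hr x' j (by linarith) (by linarith)).trans_lt hx')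
    (by rw [hmass]; exact hρ.1) (by rw [hmass]; exact hρ'.1)
    (fun s hs => by
      rw [marg_real_apply _ _ hs, marg_real_apply _ _ hs]
      exact hχ.abs_mollify_real_sub_le ρ ρ' (measurable_coord j hs))
  rw [PiLp.sub_apply, med_apply, med_apply]
  refine hmain.trans_eq ?_
  congr 2
  ring

end
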